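/- For every integer n ≥ 3, in the set S_n(132,213): f_{123}(S_n(132,213)) = (n−4)·2^{n−1} + n + 2; f_{231}(S_n(132,213)) = f_{312}(S_n(132,213)) = (n²−7n+16)·2^{n−2} − n − 4; and 3·f_{321}(S_n(132,213)) = (n³−9n²+38n−72)·2^{n−2} + 3n + 18 (i.e., f_{321}(S_n(132,213)) = (n³/3 − 3n² + 38n/3 − 24)·2^{n−2} + n + 6). -/

import Mathlib

open Finset

/-- Number of occurrences of the length-3 pattern `q` (given by its sequence of values)
in the permutation `σ` of `Fin n`: triples of indices `ι 0 < ι 1 < ι 2` whose values under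
`σ` are in the same relative order as the values of `q`. -/
def occ (n : ℕ) (q : Fin 3 → ℕ) (σ : Equiv.Perm (Fin n)) : ℕ :=
  (Finset.univ.filter fun ι : Fin 3 → Fin n =>
    (∀ j l : Fin 3, j < l → ι j < ι l) ∧
    (∀ j l : Fin 3, q j < q l ↔ σ (ι j) < σ (ι l))).card

/-- The set `S_n(R)` of permutations of `{1,…,n}` avoiding every pattern in `R`. -/
def avoiders (n : ℕ) (R : List (Fin 3 → ℕ)) : Finset (Equiv.Perm (Fin n)) :=
  Finset.univ.filter fun σ => ∀ q ∈ R, occ n q σ = 0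

/-- `f_q(S_n(R))`: the total number of occurrences of the pattern `q` among
all permutations in `S_n(R)`. -/
def fCnt (n : ℕ) (q : Fin 3 → ℕ) (R : List (Fin 3 → ℕ)) : ℕ :=
  ∑ σ ∈ avoiders n R, occ n q σ

def p123 : Fin 3 → ℕ := ![1, 2, 3]
def p132 : Fin 3 → ℕ := ![1, 3, 2]
def p213 : Fin 3 → ℕ := ![2, 1, 3]
def p231 : Fin 3 → ℕ := ![2, 3, 1]
def p312 : Fin 3 → ℕ := ![3, 1, 2]
def p321 : Fin 3 → ℕ := ![3, 2, 1]

/-- A permutation takes only intermediate values between two positions in increasing order. -/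
def ValueConvex {n : ℕ} (σ : Equiv.Perm (Fin n)) : Prop :=
  ∀ i j k : Fin n, i < j → j < k → σ i < σ k → σ i < σ j ∧ σ j < σ k

lemma occ_eq_zero_iff {n : ℕ} (q : Fin 3 → ℕ) (σ : Equiv.Perm (Fin n)) :
    occ n q σ = 0 ↔ ∀ i j k : Fin n, i < j → j < k →
      ¬ ∀ a b : Fin 3, q a < q b ↔ σ (![i, j, k] a) < σ (![i, j, k] b) := by
  unfold occ
  rw [Finset.card_eq_zero, Finset.filter_eq_empty_iff]
  constructor
  · intro h i j k hij hjk hq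
    refine h (Finset.mem_univ ![i, j, k]) ⟨?_, hq⟩
    have := hij.trans hjk
    intro a b hab
    fin_cases a <;> fin_cases b <;> simp_all
  · rintro h ι - ⟨h1, h2⟩
    have hι : ι = ![ι 0, ι 1, ι 2] := by
      ext a; fin_cases a <;> rfl
    refine h (ι 0) (ι 1) (ι 2) (h1 0 1 (by decide)) (h1 1 2 (by decide)) ?_
    rw [← hι]
    exact h2

lemma forall_fin_three {P : Fin 3 → Prop} : (∀ j, P j) ↔ P 0 ∧ P 1 ∧ P 2 := by
  simp [Fin.forall_fin_succ]

lemma mem_avoiders_iff {n : ℕ} (σ : Equiv.Perm (Fin n)) :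
    σ ∈ avoiders n [p132, p213] ↔ ValueConvex σ := by
  simp only [avoiders, Finset.mem_filter, Finset.mem_univ, true_and, List.mem_cons,
    List.not_mem_nil, or_false, forall_eq_or_imp, forall_eq, occ_eq_zero_iff, ValueConvex,
    ← forall_and]
  refine forall_congr' fun i => forall_congr' fun j => forall_congr' fun k => ?_
  have inj : ∀ a b : Fin n, a < b → (σ a : ℕ) ≠ σ b := fun a b hab h =>
    hab.ne (σ.injective (Fin.ext h))
  refine imp_congr_right fun hij => imp_congr_right fun hjk => ?_
  have h1 := inj i j hij
  have h2 := inj j k hjk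
  simp [forall_fin_three, p132, p213]
  omega

/-- The positions of the descents of a permutation. -/
def descents {m : ℕ} (σ : Equiv.Perm (Fin (m + 1))) : Finset (Fin m) :=
  Finset.univ.filter fun r => σ r.succ < σ r.castSucc

lemma ValueConvex.le_iff {m : ℕ} {σ : Equiv.Perm (Fin (m + 1))} (hσ : ValueConvex σ)
    {i j : Fin (m + 1)} (hij : i ≤ j) :
    σ i ≤ σ j ↔ ∀ r ∈ descents σ, ¬ ((i : ℕ) ≤ r ∧ (r : ℕ) < j) := by
  constructor
  · rintro h r hr ⟨h1, h2⟩
    have hd : σ r.succ < σ r.castSucc := by simpa [descents] using hr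
    have hrj : r.castSucc < j := by simpa [Fin.lt_def] using h2
    have hlt : ∀ a b : Fin (m + 1), a < b → σ a ≤ σ b → σ a < σ b := fun a b hab h =>
      lt_of_le_of_ne h fun e => hab.ne (σ.injective e)
    have hrj' : σ r.castSucc < σ j := by
      rcases (show i ≤ r.castSucc by simpa [Fin.le_def] using h1).eq_or_lt with e | e
      · exact e ▸ hlt _ _ (e ▸ hrj) h
      · exact (hσ i r.castSucc j e hrj (hlt _ _ (e.trans hrj) h)).2
    rcases (show r.succ ≤ j by simp [Fin.le_def]; omega).eq_or_lt with e | e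
    · rw [e] at hd
      exact lt_asymm hd hrj'
    · exact lt_asymm hd (hσ _ r.succ j Fin.castSucc_lt_succ e hrj').1
  · intro h
    induction j using Fin.induction with
    | zero => rw [Fin.le_zero_iff.mp hij]
    | succ r ih =>
      rcases hij.eq_or_lt with e | e
      · rw [e]
      · have hle : i ≤ r.castSucc := by
          simp [Fin.le_def, Fin.lt_def] at e ⊢; omega
        refine (ih hle fun s hs hs' => h s hs ?_).trans ?_
        · simp at hs' ⊢; omega
        · by_contra hc
          refine h r (by simpa [descents] using hc) ?_
          simp [Fin.le_def] at hle ⊢; omega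

lemma perm_eq_of_forall_le_iff {n : ℕ} {σ τ : Equiv.Perm (Fin n)}
    (h : ∀ i j, i ≤ j → (σ i ≤ σ j ↔ τ i ≤ τ j)) : σ = τ := by
  have h' : ∀ i j, σ i ≤ σ j ↔ τ i ≤ τ j := by
    intro i j
    rcases lt_or_ge j i with hij | hij
    · have hs : σ i ≠ σ j := fun e => hij.ne' (σ.injective e)
      have ht : τ i ≠ τ j := fun e => hij.ne' (τ.injective e)
      have := h j i hij.le
      grind
    · exact h i j hij
  let e : Fin n ≃o Fin n :=
    { toEquiv := σ.symm.trans τ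
      map_rel_iff' := by
        intro a b
        simpa using (h' (σ.symm a) (σ.symm b)).symm }
  ext i
  have : e (σ i) = σ i := by
    rw [Subsingleton.elim e (OrderIso.refl _)]; rfl
  have h2 : e (σ i) = τ i := by simp [e]
  rw [← this, h2]

lemma exists_valueConvex_descents_eq {m : ℕ} (S : Finset (Fin m)) :
    ∃ σ : Equiv.Perm (Fin (m + 1)), ValueConvex σ ∧ descents σ = S := by
  let b : ℕ → ℕ := fun i => (S.filter fun r : Fin m => (r : ℕ) < i).card
  have hb : Monotone b := fun i j hij =>
    Finset.card_le_card fun r hr => by simp at hr ⊢; exact ⟨hr.1, by omega⟩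
  have hbs : ∀ r : Fin m, r ∈ S ↔ b r < b (r + 1) := by
    intro r
    constructor
    · intro hr
      refine Finset.card_lt_card (Finset.ssubset_iff.mpr ⟨r, by simp, fun s hs => ?_⟩)
      simp at hs ⊢
      rcases hs with rfl | hs
      · exact ⟨hr, by omega⟩
      · exact ⟨hs.1, by omega⟩
    · intro h
      by_contra hr
      refine h.not_ge (Finset.card_le_card fun s hs => ?_)
      simp at hs ⊢
      refine ⟨hs.1, lt_of_le_of_ne (by omega) fun e => hr (e ▸ hs.1)⟩
  let f : Fin (m + 1) → ℤ ×ₗ ℕ := fun i => toLex (-(b i : ℤ), (i : ℕ))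
  have hf : Function.Injective f := fun i j h => by
    have := congrArg (fun x => (ofLex x).2) h
    exact Fin.ext this
  have hlt : ∀ i j, f i < f j ↔ b j < b i ∨ b i = b j ∧ i < j := by
    intro i j
    simp [f, Prod.Lex.toLex_lt_toLex]
  have hsm : StrictMono (f ∘ Tuple.sort f) :=
    (Tuple.monotone_sort f).strictMono_of_injective (hf.comp (Tuple.sort f).injective)
  have hσ : ∀ i j, (Tuple.sort f).symm i < (Tuple.sort f).symm j ↔ f i < f j := by
    intro i j
    rw [← hsm.lt_iff_lt]
    simp
  refine ⟨(Tuple.sort f).symm, ?_, ?_⟩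
  · intro i j k hij hjk
    simp only [hσ, hlt]
    have h1 := hb (show (i : ℕ) ≤ j from hij.le)
    have h2 := hb (show (j : ℕ) ≤ k from hjk.le)
    rintro (h | h)
    · omega
    · exact ⟨Or.inr ⟨by omega, hij⟩, Or.inr ⟨by omega, hjk⟩⟩
  · ext r
    simp only [descents, Finset.mem_filter, Finset.mem_univ, true_and, hσ, hlt, hbs]
    have : ¬ r.succ < r.castSucc := by simp [Fin.lt_def]
    simp [this]

lemma card_filter_avoiders_le {m : ℕ} {i j : Fin (m + 1)} (hij : i ≤ j) :
    ((avoiders (m + 1) [p132, p213]).filter fun σ => σ i ≤ σ j).card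
      = 2 ^ (m - ((j : ℕ) - i)) := by
  have h1 : ((avoiders (m + 1) [p132, p213]).filter fun σ => σ i ≤ σ j).card
      = (Finset.univ.filter fun r : Fin m => ¬ ((i : ℕ) ≤ r ∧ (r : ℕ) < j)).powerset.card := by
    refine Finset.card_bij (fun σ _ => descents σ) ?_ ?_ ?_
    · intro σ hσ
      rw [Finset.mem_filter, mem_avoiders_iff] at hσ
      rw [Finset.mem_powerset]
      intro r hr
      exact Finset.mem_filter.mpr ⟨Finset.mem_univ _, (hσ.1.le_iff hij).mp hσ.2 r hr⟩
    · intro σ hσ τ hτ h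
      rw [Finset.mem_filter, mem_avoiders_iff] at hσ hτ
      refine perm_eq_of_forall_le_iff fun a b hab => ?_
      rw [hσ.1.le_iff hab, hτ.1.le_iff hab, h]
    · intro S hS
      obtain ⟨σ, hσ, rfl⟩ := exists_valueConvex_descents_eq S
      refine ⟨σ, ?_, rfl⟩
      rw [Finset.mem_filter, mem_avoiders_iff, hσ.le_iff hij]
      refine ⟨hσ, fun r hr => ?_⟩
      exact (Finset.mem_filter.mp (Finset.mem_powerset.mp hS hr)).2
  have h2 : (Finset.univ.filter fun r : Fin m => (i : ℕ) ≤ r ∧ (r : ℕ) < j).card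
      = (j : ℕ) - i := by
    rw [← Nat.card_Ico, ← Finset.card_map Fin.valEmbedding]
    congr 1
    ext x
    simp only [Finset.mem_map, Finset.mem_filter, Finset.mem_univ, true_and,
      Fin.valEmbedding_apply, Finset.mem_Ico]
    constructor
    · rintro ⟨r, hr, rfl⟩; exact hr
    · intro hx; exact ⟨⟨x, by omega⟩, hx, rfl⟩
  have h3 := Finset.card_filter_add_card_filter_not (s := (Finset.univ : Finset (Fin m)))
    (fun r : Fin m => (i : ℕ) ≤ r ∧ (r : ℕ) < j)
  rw [h1, Finset.card_powerset]
  congr 1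
  simp only [Finset.card_univ, Fintype.card_fin] at h3
  omega

lemma sum_avoiders_indicator_le {m : ℕ} {i j : Fin (m + 1)} (hij : i ≤ j) :
    (∑ σ ∈ avoiders (m + 1) [p132, p213], if σ i ≤ σ j then (1 : ℚ) else 0)
      = 2 ^ m * (2 ^ (i : ℕ) / 2 ^ (j : ℕ)) := by
  rw [Finset.sum_boole, card_filter_avoiders_le hij]
  push_cast
  have : (i : ℕ) ≤ j := hij
  rw [mul_div_assoc', eq_div_iff (by positivity), ← pow_add, ← pow_add]
  congr 1
  omega

lemma sum_strictMono_triple (n : ℕ) (g : ℕ → ℕ → ℕ → ℚ) :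
    (∑ ι ∈ Finset.univ.filter fun ι : Fin 3 → Fin n => ∀ j l : Fin 3, j < l → ι j < ι l,
      g (ι 0) (ι 1) (ι 2))
      = ∑ k ∈ Finset.range n, ∑ j ∈ Finset.range k, ∑ i ∈ Finset.range j, g i j k := by
  simp_rw [Finset.sum_sigma']
  refine Finset.sum_bij (fun ι _ => ⟨(ι 2 : ℕ), ⟨(ι 1 : ℕ), (ι 0 : ℕ)⟩⟩) ?_ ?_ ?_ ?_
  · intro ι hι
    have h := (Finset.mem_filter.mp hι).2
    simpa using ⟨h 1 2 (by decide), h 0 1 (by decide)⟩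
  · intro ι _ κ _ h
    simp at h
    ext a
    fin_cases a <;> simp [h]
  · rintro ⟨k, ⟨j, i⟩⟩ h
    simp at h
    refine ⟨![⟨i, by omega⟩, ⟨j, by omega⟩, ⟨k, by omega⟩], ?_, rfl⟩
    rw [Finset.mem_filter]
    refine ⟨Finset.mem_univ _, fun a b hab => ?_⟩
    fin_cases a <;> fin_cases b <;> simp at hab ⊢ <;> omega
  · intro ι _
    rfl

/-- Summing the indicator of a pattern over avoiders, when that indicator is a combination of the
indicators of the non-inversions among three positions. -/
lemma fCnt_eq_sum {m : ℕ} (q : Fin 3 → ℕ) (a b c d : ℚ)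
    (hq : ∀ v : Fin 3 → Fin (m + 1), Function.Injective v →
      (v 0 < v 2 → v 0 < v 1 ∧ v 1 < v 2) →
      (if ∀ j l : Fin 3, q j < q l ↔ v j < v l then (1 : ℚ) else 0)
        = a + b * (if v 0 ≤ v 1 then 1 else 0) + c * (if v 1 ≤ v 2 then 1 else 0)
          + d * (if v 0 ≤ v 2 then 1 else 0)) :
    (fCnt (m + 1) q [p132, p213] : ℚ) = 2 ^ m *
      ∑ k ∈ Finset.range (m + 1), ∑ j ∈ Finset.range k, ∑ i ∈ Finset.range j,
        (a + b * (2 ^ i / 2 ^ j) + c * (2 ^ j / 2 ^ k) + d * (2 ^ i / 2 ^ k)) := by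
  have hocc : ∀ σ, (occ (m + 1) q σ : ℚ) =
      ∑ ι ∈ Finset.univ.filter fun ι : Fin 3 → Fin (m + 1) => ∀ j l : Fin 3, j < l → ι j < ι l,
        if ∀ j l : Fin 3, q j < q l ↔ σ (ι j) < σ (ι l) then (1 : ℚ) else 0 := by
    intro σ
    rw [Finset.sum_boole, occ, Finset.filter_filter]
  rw [fCnt, Nat.cast_sum]
  simp_rw [hocc]
  rw [Finset.sum_comm, ← sum_strictMono_triple, Finset.mul_sum]
  refine Finset.sum_congr rfl fun ι hι => ?_
  have h := (Finset.mem_filter.mp hι).2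
  have hinj : Function.Injective ι := StrictMono.injective fun j l hjl => h j l hjl
  have hsum := Finset.sum_congr rfl fun (σ : Equiv.Perm (Fin (m + 1)))
    (hσ : σ ∈ avoiders (m + 1) [p132, p213]) => hq (σ ∘ ι) (σ.injective.comp hinj)
      ((mem_avoiders_iff σ).mp hσ _ _ _ (h 0 1 (by decide)) (h 1 2 (by decide)))
  simp only [Function.comp_apply] at hsum
  rw [hsum]
  have h0 := sum_avoiders_indicator_le (le_refl (ι 0))
  simp only [le_refl, if_true] at h0
  rw [div_self (by positivity), mul_one] at h0
  have ha : (∑ σ ∈ avoiders (m + 1) [p132, p213], a) = a * 2 ^ m := by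
    rw [← h0, Finset.mul_sum]; simp
  simp only [Finset.sum_add_distrib, ← Finset.mul_sum]
  rw [ha, sum_avoiders_indicator_le (h 0 1 (by decide)).le,
    sum_avoiders_indicator_le (h 1 2 (by decide)).le,
    sum_avoiders_indicator_le (h 0 2 (by decide)).le]
  ring

lemma sum_range_triple (a b c d : ℚ) (n : ℕ) :
    ∑ k ∈ Finset.range n, ∑ j ∈ Finset.range k, ∑ i ∈ Finset.range j,
        (a + b * (2 ^ i / 2 ^ j) + c * (2 ^ j / 2 ^ k) + d * (2 ^ i / 2 ^ k))
      = a * ((n : ℚ) * (n - 1) * (n - 2) / 6)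
        + (b + c) * ((n : ℚ) ^ 2 / 2 - 5 * n / 2 + 4 - 4 / 2 ^ n)
        + d * (n - 4 + (2 * n + 4) / 2 ^ n) := by
  have inner : ∀ (x y : ℚ) (j : ℕ), ∑ i ∈ Finset.range j, (x + y * 2 ^ i)
      = x * j + y * (2 ^ j - 1) := by
    intro x y j
    induction j with
    | zero => simp
    | succ j ih => rw [Finset.sum_range_succ, ih]; push_cast; ring
  have middle : ∀ (k K : ℕ), ∑ j ∈ Finset.range k, ∑ i ∈ Finset.range j,
      (a + b * (2 ^ i / 2 ^ j) + c * (2 ^ j / 2 ^ K) + d * (2 ^ i / 2 ^ K))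
      = a * ((k : ℚ) * (k - 1) / 2) + b * (k - 2 + 2 / 2 ^ k)
        + c * (((k - 2) * 2 ^ k + 2) / 2 ^ K) + d * ((2 ^ k - 1 - k) / 2 ^ K) := by
    intro k K
    induction k with
    | zero => simp
    | succ k ih =>
      have := inner (a + c * (2 ^ k / 2 ^ K)) (b / 2 ^ k + d / 2 ^ K) k
      rw [Finset.sum_range_succ, ih, Finset.sum_congr rfl fun i _ =>
        show _ = a + c * (2 ^ k / 2 ^ K) + (b / 2 ^ k + d / 2 ^ K) * 2 ^ i by ring, this]
      push_cast
      field_simp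
      ring
  simp_rw [fun k => middle k k]
  induction n with
  | zero => norm_num
  | succ n ih =>
    rw [Finset.sum_range_succ, ih]
    push_cast
    field_simp
    ring

lemma fCnt_p123 (m : ℕ) : (fCnt (m + 1) p123 [p132, p213] : ℚ) = 2 ^ m *
    ∑ k ∈ Finset.range (m + 1), ∑ j ∈ Finset.range k, ∑ i ∈ Finset.range j,
      (0 + 0 * (2 ^ i / 2 ^ j) + 0 * (2 ^ j / 2 ^ k) + 1 * (2 ^ i / 2 ^ k) : ℚ) := by
  refine fCnt_eq_sum _ _ _ _ _ fun v hinj hv => ?_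
  have h01 := hinj.ne (show (0 : Fin 3) ≠ 1 by decide)
  have h12 := hinj.ne (show (1 : Fin 3) ≠ 2 by decide)
  have h02 := hinj.ne (show (0 : Fin 3) ≠ 2 by decide)
  rcases lt_or_gt_of_ne h01 with h1 | h1 <;> rcases lt_or_gt_of_ne h12 with h2 | h2 <;>
    rcases lt_or_gt_of_ne h02 with h3 | h3 <;>
    simp [forall_fin_three, p123, h1, h2, h3, h1.le, h2.le, h3.le, h1.not_gt, h2.not_gt,
      h3.not_gt, h1.not_ge, h2.not_ge, h3.not_ge] at hv ⊢

lemma fCnt_p231 (m : ℕ) : (fCnt (m + 1) p231 [p132, p213] : ℚ) = 2 ^ m *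
    ∑ k ∈ Finset.range (m + 1), ∑ j ∈ Finset.range k, ∑ i ∈ Finset.range j,
      (0 + 1 * (2 ^ i / 2 ^ j) + 0 * (2 ^ j / 2 ^ k) + -1 * (2 ^ i / 2 ^ k) : ℚ) := by
  refine fCnt_eq_sum _ _ _ _ _ fun v hinj hv => ?_
  have h01 := hinj.ne (show (0 : Fin 3) ≠ 1 by decide)
  have h12 := hinj.ne (show (1 : Fin 3) ≠ 2 by decide)
  have h02 := hinj.ne (show (0 : Fin 3) ≠ 2 by decide)
  rcases lt_or_gt_of_ne h01 with h1 | h1 <;> rcases lt_or_gt_of_ne h12 with h2 | h2 <;>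
    rcases lt_or_gt_of_ne h02 with h3 | h3 <;>
    simp [forall_fin_three, p231, h1, h2, h3, h1.le, h2.le, h3.le, h1.not_gt, h2.not_gt,
      h3.not_gt, h1.not_ge, h2.not_ge, h3.not_ge] at hv ⊢
  all_goals order

lemma fCnt_p312 (m : ℕ) : (fCnt (m + 1) p312 [p132, p213] : ℚ) = 2 ^ m *
    ∑ k ∈ Finset.range (m + 1), ∑ j ∈ Finset.range k, ∑ i ∈ Finset.range j,
      (0 + 0 * (2 ^ i / 2 ^ j) + 1 * (2 ^ j / 2 ^ k) + -1 * (2 ^ i / 2 ^ k) : ℚ) := by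
  refine fCnt_eq_sum _ _ _ _ _ fun v hinj hv => ?_
  have h01 := hinj.ne (show (0 : Fin 3) ≠ 1 by decide)
  have h12 := hinj.ne (show (1 : Fin 3) ≠ 2 by decide)
  have h02 := hinj.ne (show (0 : Fin 3) ≠ 2 by decide)
  rcases lt_or_gt_of_ne h01 with h1 | h1 <;> rcases lt_or_gt_of_ne h12 with h2 | h2 <;>
    rcases lt_or_gt_of_ne h02 with h3 | h3 <;>
    simp [forall_fin_three, p312, h1, h2, h3, h1.le, h2.le, h3.le, h1.not_gt, h2.not_gt,
      h3.not_gt, h1.not_ge, h2.not_ge, h3.not_ge] at hv ⊢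
  all_goals order

lemma fCnt_p321 (m : ℕ) : (fCnt (m + 1) p321 [p132, p213] : ℚ) = 2 ^ m *
    ∑ k ∈ Finset.range (m + 1), ∑ j ∈ Finset.range k, ∑ i ∈ Finset.range j,
      (1 + -1 * (2 ^ i / 2 ^ j) + -1 * (2 ^ j / 2 ^ k) + 1 * (2 ^ i / 2 ^ k) : ℚ) := by
  refine fCnt_eq_sum _ _ _ _ _ fun v hinj hv => ?_
  have h01 := hinj.ne (show (0 : Fin 3) ≠ 1 by decide)
  have h12 := hinj.ne (show (1 : Fin 3) ≠ 2 by decide)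
  have h02 := hinj.ne (show (0 : Fin 3) ≠ 2 by decide)
  rcases lt_or_gt_of_ne h01 with h1 | h1 <;> rcases lt_or_gt_of_ne h12 with h2 | h2 <;>
    rcases lt_or_gt_of_ne h02 with h3 | h3 <;>
    simp [forall_fin_three, p321, h1, h2, h3, h1.le, h2.le, h3.le, h1.not_gt, h2.not_gt,
      h3.not_gt, h1.not_ge, h2.not_ge, h3.not_ge] at hv ⊢
  all_goals order

/-- Theorem `tb1`: pattern counts in `S_n(132,213)` for `n ≥ 3`. -/
theorem stmt_5 (n : ℕ) (hn : 3 ≤ n) :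
    (fCnt n p123 [p132, p213] : ℤ) = ((n : ℤ) - 4) * 2 ^ (n - 1) + n + 2 ∧
    fCnt n p231 [p132, p213] = fCnt n p312 [p132, p213] ∧
    (fCnt n p231 [p132, p213] : ℤ) = ((n : ℤ) ^ 2 - 7 * n + 16) * 2 ^ (n - 2) - n - 4 ∧
    3 * (fCnt n p321 [p132, p213] : ℤ) =
      ((n : ℤ) ^ 3 - 9 * n ^ 2 + 38 * n - 72) * 2 ^ (n - 2) + 3 * n + 18 := by
  obtain ⟨m, rfl⟩ : ∃ m, n = m + 2 := ⟨n - 2, by omega⟩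
  have h123 := fCnt_p123 (m + 1)
  have h231 := fCnt_p231 (m + 1)
  have h312 := fCnt_p312 (m + 1)
  have h321 := fCnt_p321 (m + 1)
  rw [sum_range_triple] at h123 h231 h312 h321
  have e1 : m + 2 - 1 = m + 1 := rfl
  have e2 : m + 2 - 2 = m := rfl
  rw [e1, e2]
  refine ⟨?_, ?_, ?_, ?_⟩
  · qify
    rw [h123]
    push_cast
    field_simp
    ring
  · qify
    rw [h231, h312]
    ring
  · qify
    rw [h231]
    push_cast
    field_simp
    ring
  · qify
    rw [h321]
    push_cast
    field_simp
    ring
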